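/- arXiv:2009.02709 — 2 statements merged into one kernel-verified Lean document; each statement's English description precedes it below -/
import Mathlib

section
/- Identification radius: let 𝒢 be a finite collection of groups; for each g ∈ 𝒢, fix β*_g with int ∂Ω_g(β*_g) ≠ ∅, and let θ̂ ∈ ℝⁿ. Define the active set 𝒜 = {g ∈ 𝒢 : X_g^⊤ θ̂ ∉ int ∂Ω_g(β*_g)}, its complement 𝒵 = 𝒢 ∖ 𝒜, and for a set ℛ the safe active set 𝒜_ℛ = {g ∈ 𝒢 : X_g^⊤ ℛ ⊄ int ∂Ω_g(β*_g)}. Let δ_𝒵 := (1/2) inf { (σ_{∂Ω_g(β*_g)}(d) − ⟨θ̂, X_g d⟩)/‖X_g d‖ : g ∈ 𝒵, ‖d‖ = 1, X_g d ≠ 0 } (with δ_𝒵 = +∞ if the index set is empty). Then for every closed ball B(c,r) with θ̂ ∈ B(c,r) and 0 ≤ r < δ_𝒵, one has 𝒜_{B(c,r)} = 𝒜. -/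
noncomputable section

/-- The subdifferential of an extended-real-valued function `h` at `x`. -/
def subdiff {m : ℕ} (h : EuclideanSpace ℝ (Fin m) → EReal)
    (x : EuclideanSpace ℝ (Fin m)) : Set (EuclideanSpace ℝ (Fin m)) :=
  {v | ∀ z, h x + ((inner ℝ v (z - x) : ℝ) : EReal) ≤ h z}

/-- Support function of a set: `σ_C(d) = sup_{c ∈ C} ⟨c, d⟩`. -/
def sfun {m : ℕ} (C : Set (EuclideanSpace ℝ (Fin m))) (d : EuclideanSpace ℝ (Fin m)) : EReal :=
  ⨆ c ∈ C, ((inner ℝ c d : ℝ) : EReal)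

/-- Convexity for an extended-real-valued function. -/
def ERealConvexOn {m : ℕ} (h : EuclideanSpace ℝ (Fin m) → EReal) : Prop :=
  ∀ x y : EuclideanSpace ℝ (Fin m), ∀ a b : ℝ, 0 ≤ a → 0 ≤ b → a + b = 1 →
    h (a • x + b • y) ≤ (a : EReal) * h x + (b : EReal) * h y

/-- `X_g v` for a matrix `X_g ∈ ℝ^{n×m}` and `v ∈ ℝ^m`. -/
def mv {n m : ℕ} (Xg : Matrix (Fin n) (Fin m) ℝ) (v : EuclideanSpace ℝ (Fin m)) :
    EuclideanSpace ℝ (Fin n) :=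
  WithLp.toLp 2 (fun i => ∑ j, Xg i j * v j)

/-- `X_g^⊤ θ` for a matrix `X_g ∈ ℝ^{n×m}` and `θ ∈ ℝⁿ`. -/
def mvT {n m : ℕ} (Xg : Matrix (Fin n) (Fin m) ℝ) (θ : EuclideanSpace ℝ (Fin n)) :
    EuclideanSpace ℝ (Fin m) :=
  WithLp.toLp 2 (fun j => ∑ i, Xg i j * θ i)

theorem mv_adj {n m : ℕ} (A : Matrix (Fin n) (Fin m) ℝ) (θ : EuclideanSpace ℝ (Fin n))
    (d : EuclideanSpace ℝ (Fin m)) : inner ℝ (mvT A θ) d = inner ℝ θ (mv A d) := by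
  simp only [mv, mvT, PiLp.inner_apply, RCLike.inner_apply, conj_trivial, Finset.mul_sum,
    Finset.sum_mul]
  rw [Finset.sum_comm]
  refine Finset.sum_congr rfl fun i _ => Finset.sum_congr rfl fun j _ => ?_
  ring

theorem subdiff_convex {m : ℕ} (h : EuclideanSpace ℝ (Fin m) → EReal)
    (x : EuclideanSpace ℝ (Fin m)) (hb : ∀ z, h z ≠ ⊥) (ht : h x ≠ ⊤) :
    Convex ℝ (subdiff h x) := by
  intro u hu v hv a b ha hb' hab z
  have hu := hu z
  have hv := hv z
  have hxb := hb x
  have hzb := hb z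
  revert hu hv hxb hzb ht
  generalize h x = p
  generalize h z = q
  intro hp hu hv hpb hqb
  lift p to ℝ using ⟨hp, hpb⟩
  by_cases hq : q = ⊤
  · simp [hq]
  lift q to ℝ using ⟨hq, hqb⟩
  norm_cast at hu hv ⊢
  rw [inner_add_left, real_inner_smul_left, real_inner_smul_left]
  have : b = 1 - a := by linarith
  subst this
  nlinarith [mul_le_mul_of_nonneg_left hu ha, mul_le_mul_of_nonneg_left hv hb']

theorem key {n m : ℕ} (A : Matrix (Fin n) (Fin m) ℝ) (C : Set (EuclideanSpace ℝ (Fin m)))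
    (hC : Convex ℝ C) (θ θ' : EuclideanSpace ℝ (Fin n)) (h : mvT A θ ∈ interior C)
    (h' : mvT A θ' ∉ interior C) :
    ∃ d : EuclideanSpace ℝ (Fin m), ‖d‖ = 1 ∧ mv A d ≠ 0 ∧
      (sfun C d - ((inner ℝ θ (mv A d) : ℝ) : EReal)) / ((‖mv A d‖ : ℝ) : EReal)
        ≤ ((‖θ' - θ‖ : ℝ) : EReal) := by
  obtain ⟨f, hf⟩ := geometric_hahn_banach_open_point hC.interior isOpen_interior h'
  obtain ⟨e, he⟩ := (InnerProductSpace.toDual ℝ (EuclideanSpace ℝ (Fin m))).surjective f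
  have hfe : ∀ a, f a = inner ℝ a e := by
    intro a
    rw [← he, InnerProductSpace.toDual_apply_apply, real_inner_comm]
  have he0 : e ≠ 0 := by
    rintro rfl
    have := hf _ h
    simp [hfe] at this
  have hen : 0 < ‖e‖ := norm_pos_iff.2 he0
  have hlt : ∀ a ∈ interior C, inner ℝ a (‖e‖⁻¹ • e) < inner ℝ (mvT A θ') (‖e‖⁻¹ • e) := by
    intro a ha
    have := hf a ha
    rw [hfe, hfe] at this
    rw [real_inner_smul_right, real_inner_smul_right]
    exact mul_lt_mul_of_pos_left this (by positivity)
  have hd : ‖‖e‖⁻¹ • e‖ = 1 := by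
    rw [norm_smul, norm_inv, norm_norm, inv_mul_cancel₀ hen.ne']
  generalize ‖e‖⁻¹ • e = d at hlt hd
  have hle : ∀ a ∈ C, inner ℝ a d ≤ inner ℝ (mvT A θ') d := by
    intro a ha
    have hcl : a ∈ closure (interior C) := by
      rw [hC.closure_interior_eq_closure_of_nonempty_interior ⟨_, h⟩]
      exact subset_closure ha
    have hcc : IsClosed {a : EuclideanSpace ℝ (Fin m) | inner ℝ a d ≤ inner ℝ (mvT A θ') d} :=
      isClosed_le (by fun_prop) (by fun_prop)
    exact closure_minimal (fun a ha => (hlt a ha).le) hcc hcl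
  have h1 := hlt _ h
  rw [mv_adj, mv_adj] at h1
  have hne : mv A d ≠ 0 := by
    intro h0
    simp [h0] at h1
  refine ⟨d, hd, hne, ?_⟩
  have hpos : 0 < ‖mv A d‖ := norm_pos_iff.2 hne
  have hs : sfun C d ≤ ((inner ℝ θ' (mv A d) : ℝ) : EReal) := by
    refine iSup₂_le fun a ha => ?_
    rw [← mv_adj]
    exact_mod_cast hle a ha
  have h2 : inner ℝ θ' (mv A d) - inner ℝ θ (mv A d) ≤ ‖θ' - θ‖ * ‖mv A d‖ := by
    rw [← inner_sub_left]
    exact real_inner_le_norm _ _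
  refine (EReal.div_le_iff_le_mul (by exact_mod_cast hpos) (EReal.coe_ne_top _)).2 ?_
  refine (EReal.sub_le_sub hs le_rfl).trans ?_
  exact_mod_cast (by linarith)

/-- **Identification radius.** With the active set
`𝒜 = {g : X_g^⊤θ̂ ∉ int ∂Ω_g(β*_g)}`, its complement `𝒵`, and
`δ_𝒵 = (1/2)·inf{(σ_{∂Ω_g(β*_g)}(d) − ⟨θ̂, X_g d⟩)/‖X_g d‖ : g ∈ 𝒵, ‖d‖ = 1, X_g d ≠ 0}`
(`+∞` over the empty set), every safe ball `B(c,r)` containing `θ̂` with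
`0 ≤ r < δ_𝒵` satisfies `𝒜_{B(c,r)} = 𝒜`. -/
theorem identification_radius (n : ℕ) (G : Type) [Fintype G] (m : G → ℕ)
    (X : ∀ g : G, Matrix (Fin n) (Fin (m g)) ℝ)
    (Ω : ∀ g : G, EuclideanSpace ℝ (Fin (m g)) → EReal)
    (hΩ_ne_bot : ∀ g x, Ω g x ≠ ⊥) (hΩ_proper : ∀ g, ∃ x, Ω g x ≠ ⊤)
    (hΩ_closed : ∀ g, LowerSemicontinuous (Ω g)) (hΩ_convex : ∀ g, ERealConvexOn (Ω g))
    (βstar : ∀ g : G, EuclideanSpace ℝ (Fin (m g)))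
    (hint : ∀ g, (interior (subdiff (Ω g) (βstar g))).Nonempty)
    (θhat : EuclideanSpace ℝ (Fin n)) :
    ∀ (c : EuclideanSpace ℝ (Fin n)) (r : ℝ), θhat ∈ Metric.closedBall c r → 0 ≤ r →
      (r : EReal) < (1 / 2 : EReal) *
        sInf {t : EReal | ∃ g : G, mvT (X g) θhat ∈ interior (subdiff (Ω g) (βstar g)) ∧
          ∃ d : EuclideanSpace ℝ (Fin (m g)), ‖d‖ = 1 ∧ mv (X g) d ≠ 0 ∧
            t = (sfun (subdiff (Ω g) (βstar g)) d - ((inner ℝ θhat (mv (X g) d) : ℝ) : EReal))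
                  / ((‖mv (X g) d‖ : ℝ) : EReal)} →
      {g : G | ¬ ((fun θ => mvT (X g) θ) '' Metric.closedBall c r
          ⊆ interior (subdiff (Ω g) (βstar g)))}
        = {g : G | mvT (X g) θhat ∉ interior (subdiff (Ω g) (βstar g))} := by
  intro c r hθ hr hlt
  ext g
  simp only [Set.mem_ofPred_eq]
  refine not_congr ⟨fun h => h ⟨θhat, hθ, rfl⟩, fun h => ?_⟩
  rintro _ ⟨θ, hθ', rfl⟩
  by_contra hn
  have htop : Ω g (βstar g) ≠ ⊤ := by
    intro htop
    obtain ⟨x, hx⟩ := hΩ_proper g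
    obtain ⟨v, hv⟩ := hint g
    have := interior_subset hv x
    rw [htop, EReal.top_add_coe] at this
    exact hx (top_le_iff.1 this)
  obtain ⟨d, hd, hne, hle⟩ := key (X g) _ (subdiff_convex _ _ (hΩ_ne_bot g) htop) θhat θ h hn
  have hdist : ‖θ - θhat‖ ≤ 2 * r := by
    rw [← dist_eq_norm]
    rw [Metric.mem_closedBall] at hθ hθ'
    have := dist_triangle_right θ θhat c
    linarith
  have hhalf : (1 / 2 : EReal) = ((1 / 2 : ℝ) : EReal) := by
    rw [EReal.coe_div]
    norm_cast
  rw [hhalf] at hlt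
  refine absurd hlt (not_lt.2 ?_)
  refine (mul_le_mul_of_nonneg_left ((sInf_le ?_).trans
    (hle.trans (EReal.coe_le_coe_iff.2 hdist))) ?_).trans ?_
  · exact ⟨g, h, d, hd, hne, rfl⟩
  · exact_mod_cast (by norm_num : (0 : ℝ) ≤ 1 / 2)
  · rw [← EReal.coe_mul, EReal.coe_le_coe_iff]
    linarith
end
end

section
/- Finite active-set identification with converging safe regions: let 𝒢 be a finite collection of groups; for each g ∈ 𝒢, fix β*_g with int ∂Ω_g(β*_g) ≠ ∅, and let θ̂ ∈ ℝⁿ. Define the active set 𝒜 = {g ∈ 𝒢 : X_g^⊤ θ̂ ∉ int ∂Ω_g(β*_g)} and, for a set ℛ, the safe active set 𝒜_ℛ = {g ∈ 𝒢 : X_g^⊤ ℛ ⊄ int ∂Ω_g(β*_g)}. Let (ℛ_k)_{k∈ℕ} be a sequence of nonempty compact convex subsets of ℝⁿ with θ̂ ∈ ℛ_k for every k and diam(ℛ_k) → 0 as k → ∞. Then there exists k₀ ∈ ℕ such that 𝒜_{ℛ_k} = 𝒜 for all k ≥ k₀. -/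
noncomputable section

/-- **Finite active-set identification with converging safe regions.** If
`(ℛ_k)` is a sequence of nonempty compact convex sets all containing `θ̂` with
`diam(ℛ_k) → 0`, then there exists `k₀` such that for all `k ≥ k₀` the safe
active set `𝒜_{ℛ_k} = {g : X_g^⊤ℛ_k ⊄ int ∂Ω_g(β*_g)}` equals the active set
`𝒜 = {g : X_g^⊤θ̂ ∉ int ∂Ω_g(β*_g)}`. -/
theorem finite_active_set_identification (n : ℕ) (G : Type) [Fintype G] (m : G → ℕ)
    (X : ∀ g : G, Matrix (Fin n) (Fin (m g)) ℝ)
    (Ω : ∀ g : G, EuclideanSpace ℝ (Fin (m g)) → EReal)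
    (hΩ_ne_bot : ∀ g x, Ω g x ≠ ⊥) (hΩ_proper : ∀ g, ∃ x, Ω g x ≠ ⊤)
    (hΩ_closed : ∀ g, LowerSemicontinuous (Ω g)) (hΩ_convex : ∀ g, ERealConvexOn (Ω g))
    (βstar : ∀ g : G, EuclideanSpace ℝ (Fin (m g)))
    (hint : ∀ g, (interior (subdiff (Ω g) (βstar g))).Nonempty)
    (θhat : EuclideanSpace ℝ (Fin n))
    (R : ℕ → Set (EuclideanSpace ℝ (Fin n)))
    (hR_ne : ∀ k, (R k).Nonempty) (hR_cpt : ∀ k, IsCompact (R k))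
    (hR_cvx : ∀ k, Convex ℝ (R k)) (hθR : ∀ k, θhat ∈ R k)
    (hdiam : Filter.Tendsto (fun k => Metric.diam (R k)) Filter.atTop (nhds 0)) :
    ∃ k₀ : ℕ, ∀ k ≥ k₀,
      {g : G | ¬ ((fun θ => mvT (X g) θ) '' R k ⊆ interior (subdiff (Ω g) (βstar g)))}
        = {g : G | mvT (X g) θhat ∉ interior (subdiff (Ω g) (βstar g))} := by
  have key : ∀ g : G, ∀ᶠ k in Filter.atTop,
      (¬ ((fun θ => mvT (X g) θ) '' R k ⊆ interior (subdiff (Ω g) (βstar g)))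
        ↔ mvT (X g) θhat ∉ interior (subdiff (Ω g) (βstar g))) := by
    intro g
    by_cases h : mvT (X g) θhat ∈ interior (subdiff (Ω g) (βstar g))
    · have hc : Continuous (fun θ => mvT (X g) θ) := by
        unfold mvT
        fun_prop
      have hn : (fun θ => mvT (X g) θ) ⁻¹' interior (subdiff (Ω g) (βstar g)) ∈ nhds θhat :=
        (isOpen_interior.preimage hc).mem_nhds h
      obtain ⟨ε, hε, hb⟩ := Metric.mem_nhds_iff.1 hn
      filter_upwards [hdiam.eventually (gt_mem_nhds hε)] with k hk
      refine not_congr ⟨fun _ => h, fun _ => ?_⟩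
      rintro _ ⟨θ, hθ, rfl⟩
      exact hb (lt_of_le_of_lt
        (Metric.dist_le_diam_of_mem (hR_cpt k).isBounded hθ (hθR k)) hk)
    · exact Filter.Eventually.of_forall fun k =>
        ⟨fun _ => h, fun _ hs => h (hs ⟨θhat, hθR k, rfl⟩)⟩
  obtain ⟨k₀, hk₀⟩ := Filter.eventually_atTop.1 (Filter.eventually_all.2 key)
  exact ⟨k₀, fun k hk => Set.ext fun g => hk₀ k hk g⟩
end
end
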